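/- Let A be a skew PBW extension of R in variables x_1, …, x_n. Set F_{−1} := 0, F_0 := R and, for m ≥ 1, let F_m be the left R-span of the monomials x^α with |α| ≤ m. Then (F_m)_{m≥0} is an exhaustive increasing ring filtration of A: F_m ⊆ F_{m+1}, ⋃_m F_m = A, and F_m · F_p ⊆ F_{m+p} for all m, p ≥ 0. Moreover, the associated graded ring Gr(A) := ⊕_{m≥0} F_m/F_{m−1} is a quasi-commutative skew PBW extension of R (identified with Gr(A)_0 = F_0): setting z_i := x_i + F_0 ∈ Gr(A)_1, the monomials z^α := z_1^{α_1} ⋯ z_n^{α_n} (α ∈ ℕ^n) form a basis of Gr(A) as a left R-module, for every i and every r ∈ R ∖ {0} there exists c ∈ R ∖ {0} with z_i r = c z_i, and for all i, j there exists c_{i,j} ∈ R ∖ {0} with z_j z_i = c_{i,j} z_i z_j. If in addition A is bijective, then Gr(A) is a bijective quasi-commutative skew PBW extension of R. -/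

import Mathlib

/-- The ordered monomial `x₁^{α₁} ⋯ xₙ^{αₙ}`. -/
def skewPBWMonomial {A : Type*} [Ring A] {n : ℕ} (x : Fin n → A) (α : Fin n → ℕ) : A :=
  (List.ofFn fun i => x i ^ α i).prod

/-- `A` is a skew PBW extension of the subring `S` with variables `x₁, …, xₙ`. -/
structure IsSkewPBWExt {A : Type*} [Ring A] (S : Subring A) {n : ℕ} (x : Fin n → A) : Prop where
  linearIndependent : LinearIndependent S (skewPBWMonomial x)
  span_top : Submodule.span S (Set.range (skewPBWMonomial x)) = ⊤
  comm_coeff : ∀ (i : Fin n) (r : S), r ≠ 0 →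
    ∃ c : S, c ≠ 0 ∧ x i * (r : A) - (c : A) * x i ∈ (S : Set A)
  comm_var : ∀ i j : Fin n, ∃ c : S, c ≠ 0 ∧ ∃ (r₀ : S) (r : Fin n → S),
    x j * x i - (c : A) * (x i * x j) = (r₀ : A) + ∑ k, (r k : A) * x k

/-- `F_m`, the left `S`-submodule of `A` spanned by the standard monomials of total
degree at most `m`. -/
def skewPBWFilt {A : Type*} [Ring A] (S : Subring A) {n : ℕ} (x : Fin n → A) (m : ℕ) :
    Submodule S A :=
  Submodule.span S {a | ∃ α : Fin n → ℕ, (∑ i, α i) ≤ m ∧ a = skewPBWMonomial x α}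

/-- `F_{m−1}`, with `F_{−1} = 0`. -/
def skewPBWFiltPrev {A : Type*} [Ring A] (S : Subring A) {n : ℕ} (x : Fin n → A) :
    ℕ → Submodule S A
  | 0 => ⊥
  | (m + 1) => skewPBWFilt S x m

section SkewPBWHelpers

theorem skewPBWMonomial_cons {A : Type*} [Ring A] {n : ℕ} (x : Fin n → A) (j : Fin n)
    (α : Fin n → ℕ) (hα : ∀ i, i < j → α i = 0) :
    skewPBWMonomial x (α + Pi.single j 1) = x j * skewPBWMonomial x α := by
  unfold skewPBWMonomial
  induction n with
  | zero => exact j.elim0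
  | succ n ih =>
    rw [List.ofFn_succ, List.ofFn_succ, List.prod_cons, List.prod_cons]
    induction j using Fin.cases with
    | zero =>
      have h1 : ∀ i : Fin n, (α + Pi.single (0 : Fin (n+1)) 1 : Fin (n + 1) → ℕ) i.succ = α i.succ := by
        intro i
        simp
      simp only [h1]
      simp [pow_succ', mul_assoc]
    | succ j =>
      have h0 : α 0 = 0 := hα 0 (Fin.succ_pos j)
      have h1 : (α + Pi.single (j.succ) 1 : Fin (n + 1) → ℕ) 0 = 0 := by
        simp [h0, (Fin.succ_ne_zero j).symm]
      have h2 : ∀ i : Fin n, (α + Pi.single j.succ 1 : Fin (n + 1) → ℕ) i.succ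
          = ((fun i => α i.succ) + Pi.single j 1 : Fin n → ℕ) i := by
        intro i
        simp [Pi.single_apply]
      rw [h0, h1]
      simp only [h2]
      have := ih (fun i => x i.succ) j (fun i => α i.succ)
        (fun i hi => hα _ (Fin.succ_lt_succ_iff.2 hi))
      simpa using this

theorem skewPBWMonomial_zero {A : Type*} [Ring A] {n : ℕ} (x : Fin n → A) :
    skewPBWMonomial x 0 = 1 := by
  unfold skewPBWMonomial
  simp

theorem skewPBW_sum_add_single {n : ℕ} (α : Fin n → ℕ) (j : Fin n) :
    ∑ i, (α + Pi.single j 1 : Fin n → ℕ) i = ∑ i, α i + 1 := by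
  simp [Finset.sum_add_distrib]

/-- A nonzero exponent vector splits off its first variable. -/
theorem skewPBW_split {n : ℕ} (α : Fin n → ℕ) (k : Fin n) (hk : α k ≠ 0) :
    ∃ (i : Fin n) (β : Fin n → ℕ), i ≤ k ∧ (∀ l, l < i → β l = 0) ∧ α = β + Pi.single i 1 := by
  classical
  have hne : (Finset.univ.filter fun i => α i ≠ 0).Nonempty := ⟨k, by simp [hk]⟩
  obtain ⟨i, hi, hmin⟩ := Finset.exists_min_image _ (fun i : Fin n => i) hne
  simp only [Finset.mem_filter, Finset.mem_univ, true_and] at hi hmin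
  have hlow : ∀ l, l < i → α l = 0 := by
    intro l hl
    by_contra hc
    exact absurd (hmin l hc) (not_le.2 hl)
  refine ⟨i, α - Pi.single i 1, hmin k hk, ?_, ?_⟩
  · intro l hl
    simp [hlow l hl]
  · ext l
    by_cases hl : l = i
    · subst hl
      simp only [Pi.add_apply, Pi.sub_apply, Pi.single_eq_same]
      omega
    · simp [hl]

variable {A : Type*} [Ring A] (S : Subring A) {n : ℕ} (x : Fin n → A)

theorem skewPBWFilt_mono : Monotone (skewPBWFilt S x) := by
  intro m p hmp
  apply Submodule.span_mono
  rintro a ⟨α, hα, rfl⟩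
  exact ⟨α, hα.trans hmp, rfl⟩

theorem skewPBWMonomial_mem {m : ℕ} (α : Fin n → ℕ) (hα : ∑ i, α i ≤ m) :
    skewPBWMonomial x α ∈ skewPBWFilt S x m :=
  Submodule.subset_span ⟨α, hα, rfl⟩

theorem skewPBWFilt_exhaust (h : IsSkewPBWExt S x) (a : A) :
    ∃ m : ℕ, a ∈ skewPBWFilt S x m := by
  have ha : a ∈ Submodule.span S (Set.range (skewPBWMonomial x)) := by
    rw [h.span_top]; trivial
  induction ha using Submodule.span_induction with
  | mem a ha =>
    obtain ⟨α, rfl⟩ := ha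
    exact ⟨_, skewPBWMonomial_mem S x α le_rfl⟩
  | zero => exact ⟨0, zero_mem _⟩
  | add a b _ _ iha ihb =>
    obtain ⟨m, hm⟩ := iha
    obtain ⟨p, hp⟩ := ihb
    exact ⟨max m p, add_mem (skewPBWFilt_mono S x (le_max_left _ _) hm)
      (skewPBWFilt_mono S x (le_max_right _ _) hp)⟩
  | smul r a _ iha =>
    obtain ⟨m, hm⟩ := iha
    exact ⟨m, Submodule.smul_mem _ _ hm⟩

theorem skewPBWFilt_coe_mul {m : ℕ} (r : S) {a : A} (ha : a ∈ skewPBWFilt S x m) :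
    (r : A) * a ∈ skewPBWFilt S x m :=
  Submodule.smul_mem _ r ha

theorem skewPBWFilt_coe_mem (m : ℕ) (r : S) : (r : A) ∈ skewPBWFilt S x m := by
  have := skewPBWFilt_coe_mul S x r (skewPBWMonomial_mem S x (m := m) 0 (by simp))
  simpa [skewPBWMonomial_zero] using this

theorem skewPBWFilt_zero : (skewPBWFilt S x 0 : Set A) = (S : Set A) := by
  ext a
  constructor
  · intro ha
    change a ∈ Submodule.span S _ at ha
    induction ha using Submodule.span_induction with
    | mem a ha =>
      obtain ⟨α, hα, rfl⟩ := ha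
      have : α = 0 := by
        ext i
        have := Finset.single_le_sum (f := α) (fun _ _ => Nat.zero_le _) (Finset.mem_univ i)
        simp only [Pi.zero_apply]
        omega
      subst this
      rw [skewPBWMonomial_zero]
      exact S.one_mem
    | zero => exact S.zero_mem
    | add a b _ _ iha ihb => exact S.add_mem iha ihb
    | smul r a _ iha => exact S.mul_mem r.2 iha
  · intro ha
    exact skewPBWFilt_coe_mem S x 0 ⟨a, ha⟩

theorem skewPBWFilt_var_mem (i : Fin n) : x i ∈ skewPBWFilt S x 1 := by
  have := skewPBWMonomial_mem S x (m := 1) (0 + Pi.single i 1)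
    (by rw [skewPBW_sum_add_single]; simp)
  rw [skewPBWMonomial_cons x i 0 (by simp), skewPBWMonomial_zero, mul_one] at this
  exact this

theorem skewPBWFilt_var_mul (h : IsSkewPBWExt S x) (m : ℕ) : ∀ (j : Fin n) (a : A),
    a ∈ skewPBWFilt S x m → x j * a ∈ skewPBWFilt S x (m + 1) := by
  induction m using Nat.strong_induction_on with
  | _ m ihm =>
  intro j
  induction j using WellFoundedLT.induction with
  | _ j ihj =>
  have key : ∀ α : Fin n → ℕ, ∑ i, α i ≤ m →
      x j * skewPBWMonomial x α ∈ skewPBWFilt S x (m + 1) := by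
    intro α hα
    by_cases hlow : ∀ i, i < j → α i = 0
    · rw [← skewPBWMonomial_cons x j α hlow]
      apply skewPBWMonomial_mem
      rw [skewPBW_sum_add_single]
      omega
    · push Not at hlow
      obtain ⟨k, hkj, hk⟩ := hlow
      obtain ⟨i, β, hik, hβ, rfl⟩ := skewPBW_split α k hk
      have hij : i < j := lt_of_le_of_lt hik hkj
      rw [skewPBW_sum_add_single] at hα
      obtain ⟨q, rfl⟩ : ∃ q, m = q + 1 := ⟨m - 1, by omega⟩
      have hb : skewPBWMonomial x β ∈ skewPBWFilt S x q :=
        skewPBWMonomial_mem S x β (by omega)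
      have hv : ∀ k, x k * skewPBWMonomial x β ∈ skewPBWFilt S x (q + 1) :=
        fun k => ihm q (Nat.lt_succ_self _) k _ hb
      obtain ⟨c, -, r₀, r, hc⟩ := h.comm_var i j
      have e : x j * skewPBWMonomial x (β + Pi.single i 1)
          = (c : A) * (x i * (x j * skewPBWMonomial x β)) + ((r₀ : A) * skewPBWMonomial x β
            + ∑ k, (r k : A) * (x k * skewPBWMonomial x β)) := by
        rw [skewPBWMonomial_cons x i β hβ, ← mul_assoc, sub_eq_iff_eq_add.1 hc]
        simp only [add_mul, Finset.sum_mul, mul_assoc]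
        abel
      rw [e]
      refine add_mem (skewPBWFilt_coe_mul S x _ (ihj i hij _ (hv j))) (add_mem ?_ ?_)
      · exact skewPBWFilt_coe_mul S x _ (skewPBWFilt_mono S x (by omega) hb)
      · exact sum_mem fun k _ => skewPBWFilt_coe_mul S x _
          (skewPBWFilt_mono S x (by omega) (hv k))
  intro a ha
  unfold skewPBWFilt at ha
  induction ha using Submodule.span_induction with
  | mem a ha =>
    obtain ⟨α, hα, rfl⟩ := ha
    exact key α hα
  | zero => rw [mul_zero]; exact zero_mem _
  | add a b _ _ iha ihb => rw [mul_add]; exact add_mem iha ihb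
  | smul r a ha iha =>
    by_cases hr : r = 0
    · rw [hr, zero_smul, mul_zero]; exact zero_mem _
    · obtain ⟨c, -, hc⟩ := h.comm_coeff j r hr
      have e : x j * (r • a) = (c : A) * (x j * a) + (x j * (r : A) - (c : A) * x j) * a := by
        rw [Subring.smul_def, smul_eq_mul]
        noncomm_ring
      rw [e]
      exact add_mem (skewPBWFilt_coe_mul S x c iha)
        (skewPBWFilt_coe_mul S x ⟨_, hc⟩ (skewPBWFilt_mono S x (Nat.le_succ m) ha))

theorem skewPBWFilt_monomial_mul (h : IsSkewPBWExt S x) (p : ℕ) (b : A)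
    (hb : b ∈ skewPBWFilt S x p) : ∀ (m : ℕ) (α : Fin n → ℕ), ∑ i, α i = m →
    skewPBWMonomial x α * b ∈ skewPBWFilt S x (m + p) := by
  intro m
  induction m with
  | zero =>
    intro α hα
    have : α = 0 := by
      ext i
      simpa using (Finset.sum_eq_zero_iff.1 hα) i (Finset.mem_univ i)
    subst this
    simpa [skewPBWMonomial_zero] using hb
  | succ m ih =>
    intro α hα
    obtain ⟨k, hk⟩ : ∃ k, α k ≠ 0 := by
      by_contra hc
      push Not at hc
      simp [hc] at hα
    obtain ⟨i, β, -, hβ, rfl⟩ := skewPBW_split α k hk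
    rw [skewPBW_sum_add_single] at hα
    rw [skewPBWMonomial_cons x i β hβ, mul_assoc, show m + 1 + p = m + p + 1 by omega]
    exact skewPBWFilt_var_mul S x h _ _ _ (ih β (by omega))

theorem skewPBWFilt_mul (h : IsSkewPBWExt S x) (m p : ℕ) (a b : A)
    (ha : a ∈ skewPBWFilt S x m) (hb : b ∈ skewPBWFilt S x p) :
    a * b ∈ skewPBWFilt S x (m + p) := by
  unfold skewPBWFilt at ha
  induction ha using Submodule.span_induction with
  | mem a ha =>
    obtain ⟨α, hα, rfl⟩ := ha
    exact skewPBWFilt_mono S x (by omega) (skewPBWFilt_monomial_mul S x h p b hb _ α rfl)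
  | zero => rw [zero_mul]; exact zero_mem _
  | add a b _ _ iha ihb => rw [add_mul]; exact add_mem iha ihb
  | smul r a ha iha => rw [smul_mul_assoc]; exact Submodule.smul_mem _ _ iha

theorem skewPBWFiltPrev_eq (m : ℕ) : skewPBWFiltPrev S x m =
    Submodule.span S (skewPBWMonomial x '' {α | ∑ i, α i < m}) := by
  cases m with
  | zero => simp [skewPBWFiltPrev]
  | succ m =>
    unfold skewPBWFiltPrev skewPBWFilt
    apply congrArg (Submodule.span S)
    ext a
    constructor
    · rintro ⟨α, hα, rfl⟩
      exact ⟨α, Nat.lt_succ_of_le hα, rfl⟩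
    · rintro ⟨α, hα, rfl⟩
      exact ⟨α, Nat.le_of_lt_succ hα, rfl⟩

theorem skewPBW_eq_zero_of_mem_prev (h : IsSkewPBWExt S x) (m : ℕ) (c : (Fin n → ℕ) →₀ S)
    (hc : ∀ α, c α ≠ 0 → ∑ i, α i = m)
    (hmem : Finsupp.linearCombination S (skewPBWMonomial x) c ∈ skewPBWFiltPrev S x m) :
    c = 0 := by
  rw [skewPBWFiltPrev_eq, Finsupp.mem_span_image_iff_linearCombination] at hmem
  obtain ⟨l, hl, hlc⟩ := hmem
  have : l = c := h.linearIndependent hlc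
  subst this
  ext1 α
  by_contra hα
  have h1 := hc α hα
  have h2 : α ∈ {α : Fin n → ℕ | ∑ i, α i < m} := hl (Finsupp.mem_support_iff.2 hα)
  simp only [Set.mem_ofPred_eq] at h2
  omega

end SkewPBWHelpers

/-- the `F_m` form an exhaustive increasing ring filtration of `A` with
`F_0 = R`, and any realization `G` of the associated graded ring
`Gr(A) = ⊕ F_m/F_{m−1}` is a quasi-commutative skew PBW extension of `R`
(identified with `Gr(A)_0` via `ι`), with variables `z_i = x_i + F_0`: the monomials
`z^α` form a basis of `G` as a left `R`-module, `z_i r = c z_i` and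
`z_j z_i = c_{i,j} z_i z_j` with nonzero constants; if moreover `A` is bijective, then
`Gr(A)` is a bijective quasi-commutative skew PBW extension of `R`. -/
theorem skewPBW_filtration_assocGraded {A : Type*} [Ring A] (S : Subring A) {n : ℕ}
    (x : Fin n → A) (h : IsSkewPBWExt S x) :
    -- the filtration
    (Monotone (skewPBWFilt S x) ∧
      (∀ a : A, ∃ m : ℕ, a ∈ skewPBWFilt S x m) ∧
      ((skewPBWFilt S x 0 : Set A) = (S : Set A)) ∧
      (∀ m p : ℕ, ∀ a b : A, a ∈ skewPBWFilt S x m → b ∈ skewPBWFilt S x p →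
        a * b ∈ skewPBWFilt S x (m + p))) ∧
    -- the associated graded ring
    (∀ (G : Type _) [Ring G] (gr : ∀ m : ℕ, (skewPBWFilt S x m) →+ G),
      DirectSum.IsInternal (fun m : ℕ => (gr m).range) →
      (∀ (m : ℕ) (a : A) (ha : a ∈ skewPBWFilt S x m),
        gr m ⟨a, ha⟩ = 0 ↔ a ∈ skewPBWFiltPrev S x m) →
      (∀ (p q : ℕ) (a b : A) (ha : a ∈ skewPBWFilt S x p) (hb : b ∈ skewPBWFilt S x q)
        (hab : a * b ∈ skewPBWFilt S x (p + q)),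
        gr p ⟨a, ha⟩ * gr q ⟨b, hb⟩ = gr (p + q) ⟨a * b, hab⟩) →
      (∀ h1 : (1 : A) ∈ skewPBWFilt S x 0, gr 0 ⟨1, h1⟩ = 1) →
      ∀ (hS : ∀ r : S, (r : A) ∈ skewPBWFilt S x 0) (hx : ∀ i : Fin n, x i ∈ skewPBWFilt S x 1),
      let ι : S → G := fun r => gr 0 ⟨(r : A), hS r⟩
      let z : Fin n → G := fun i => gr 1 ⟨x i, hx i⟩
      -- Gr(A) is a quasi-commutative skew PBW extension of R
      Function.Injective ι ∧
      Function.Bijective (fun c : ((Fin n → ℕ) →₀ S) =>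
        c.sum fun α r => ι r * (List.ofFn fun i => z i ^ α i).prod) ∧
      (∀ (i : Fin n) (r : S), r ≠ 0 → ∃ c : S, c ≠ 0 ∧ z i * ι r = ι c * z i) ∧
      (∀ i j : Fin n, ∃ c : S, c ≠ 0 ∧ z j * z i = ι c * (z i * z j)) ∧
      -- bijective case
      (((∀ i : Fin n, ∃ (σ : S ≃+* S) (δ : S →+ S),
          (∀ r s : S, δ (r * s) = σ r * δ s + δ r * s) ∧
          ∀ r : S, x i * (r : A) = ((σ r : S) : A) * x i + (δ r : A)) ∧
        (∀ i j : Fin n, i < j → ∃ c : S, IsUnit c ∧ ∃ (r₀ : S) (r : Fin n → S),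
          x j * x i - (c : A) * (x i * x j) = (r₀ : A) + ∑ k, (r k : A) * x k)) →
        (∀ i : Fin n, ∃ σ : S ≃+* S, ∀ r : S, z i * ι r = ι (σ r) * z i) ∧
        (∀ i j : Fin n, i < j → ∃ c : S, IsUnit c ∧ z j * z i = ι c * (z i * z j)))) := by
  classical
  refine ⟨⟨skewPBWFilt_mono S x, skewPBWFilt_exhaust S x h, skewPBWFilt_zero S x,
    skewPBWFilt_mul S x h⟩, ?_⟩
  intro G _ gr hInternal hker hmul hone hS hx ι z
  have hcongr : ∀ (p q : ℕ) (a b : A) (ha : a ∈ skewPBWFilt S x p)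
      (hb : b ∈ skewPBWFilt S x q), p = q → a = b → gr p ⟨a, ha⟩ = gr q ⟨b, hb⟩ := by
    intro p q a b ha hb hpq hab
    subst hpq; subst hab; rfl
  have hsub : ∀ (m : ℕ) (a b : A) (ha : a ∈ skewPBWFilt S x m)
      (hb : b ∈ skewPBWFilt S x m), a - b ∈ skewPBWFiltPrev S x m →
      gr m ⟨a, ha⟩ = gr m ⟨b, hb⟩ := by
    intro m a b ha hb hab
    rw [← sub_eq_zero, ← map_sub]
    exact (hker m (a - b) (sub_mem ha hb)).2 hab
  let f : S →+* G :=
    { toFun := ι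
      map_one' := hone _
      map_zero' := (hker 0 0 (zero_mem _)).2 (zero_mem _)
      map_mul' := by
        intro r s
        exact (hmul 0 0 _ _ (hS r) (hS s) (hS (r * s))).symm
      map_add' := by
        intro r s
        exact map_add (gr 0) ⟨(r : A), hS r⟩ ⟨(s : A), hS s⟩ }
  have hιinj : Function.Injective ι := by
    refine (injective_iff_map_eq_zero f).2 ?_
    intro r hr
    have := (hker 0 (r : A) (hS r)).1 hr
    simpa [skewPBWFiltPrev] using this
  have hιmul : ∀ (r : S) (m : ℕ) (a : A) (ha : a ∈ skewPBWFilt S x m)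
      (hra : (r : A) * a ∈ skewPBWFilt S x m),
      ι r * gr m ⟨a, ha⟩ = gr m ⟨(r : A) * a, hra⟩ := by
    intro r m a ha hra
    rw [hmul 0 m _ _ (hS r) ha (by simpa using hra)]
    exact hcongr _ _ _ _ _ _ (zero_add m) rfl
  have hmon : ∀ (m : ℕ) (α : Fin n → ℕ), ∑ i, α i = m →
      ∀ hm : skewPBWMonomial x α ∈ skewPBWFilt S x m,
      skewPBWMonomial z α = gr m ⟨skewPBWMonomial x α, hm⟩ := by
    intro m
    induction m with
    | zero =>
      intro α hα hm
      have : α = 0 := by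
        ext i
        simpa using (Finset.sum_eq_zero_iff.1 hα) i (Finset.mem_univ i)
      subst this
      rw [skewPBWMonomial_zero, ← hone (hS 1)]
      exact hcongr _ _ _ _ _ _ rfl (skewPBWMonomial_zero x).symm
    | succ m ih =>
      intro α hα hm
      obtain ⟨k, hk⟩ : ∃ k, α k ≠ 0 := by
        by_contra hc
        push Not at hc
        simp [hc] at hα
      obtain ⟨i, β, -, hβ, rfl⟩ := skewPBW_split α k hk
      rw [skewPBW_sum_add_single] at hα
      have hβm : ∑ i, β i = m := by omega
      have hb := skewPBWMonomial_mem S x β hβm.le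
      rw [skewPBWMonomial_cons z i β hβ, ih β hβm hb,
        hmul 1 m _ _ (hx i) hb (skewPBWFilt_mul S x h _ _ _ _ (hx i) hb)]
      exact hcongr _ _ _ _ _ _ (add_comm 1 m) (skewPBWMonomial_cons x i β hβ).symm
  let _ : Module S G := Module.compHom G f
  have hsmul : ∀ (r : S) (g : G), r • g = ι r * g := fun r g => rfl
  let L : ∀ m, skewPBWFilt S x m →ₗ[S] G := fun m =>
    { toFun := gr m
      map_add' := map_add (gr m)
      map_smul' := by
        intro r a
        exact (hιmul r m a.1 a.2 (skewPBWFilt_coe_mul S x r a.2)).symm }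
  have hzmem : ∀ (α : Fin n → ℕ) (r : S),
      r • skewPBWMonomial z α ∈ (gr (∑ i, α i)).range := by
    intro α r
    have hm := skewPBWMonomial_mem S x α le_rfl
    rw [hmon _ α rfl hm]
    exact ⟨r • ⟨_, hm⟩, (L _).map_smul r _⟩
  have hlin : LinearIndependent S (skewPBWMonomial z) := by
    rw [linearIndependent_iff]
    intro c hc
    let y : DirectSum ℕ (fun m => (gr m).range) :=
      ∑ α ∈ c.support, DirectSum.of (fun m => (gr m).range) (∑ i, α i) ⟨_, hzmem α (c α)⟩
    have hy : y = 0 := by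
      apply hInternal.injective
      rw [map_zero, map_sum]
      simp only [DirectSum.coeAddMonoidHom_of]
      exact hc
    ext1 α
    have hyα : ((y (∑ i, α i) : (gr (∑ i, α i)).range) : G) = 0 := by rw [hy]; rfl
    set m := ∑ i, α i with hmdef
    let d := c.filter (fun β => ∑ i, β i = m)
    have hdmem : Finsupp.linearCombination S (skewPBWMonomial x) d ∈ skewPBWFilt S x m := by
      rw [Finsupp.linearCombination_apply]
      refine sum_mem fun β hβ => Submodule.smul_mem _ _ (skewPBWMonomial_mem S x β ?_)
      have := (Finsupp.mem_support_iff.1 hβ)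
      by_contra hne
      exact this (Finsupp.filter_apply_neg _ _ (by omega))
    have hd : gr m ⟨_, hdmem⟩ = 0 := by
      have e1 : (⟨_, hdmem⟩ : skewPBWFilt S x m) = ∑ β ∈ c.support,
          (if hβ : ∑ i, β i = m then
            c β • (⟨_, skewPBWMonomial_mem S x β hβ.le⟩ : skewPBWFilt S x m) else 0) := by
        ext
        rw [Submodule.coe_sum]
        change Finsupp.linearCombination S (skewPBWMonomial x) d = _
        have hsupp : d.support ⊆ c.support := by
          simp only [d, Finsupp.support_filter]
          exact Finset.filter_subset _ _
        rw [Finsupp.linearCombination_apply, Finsupp.sum_of_support_subset d hsupp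
          (fun β r => r • skewPBWMonomial x β) (fun β _ => zero_smul _ _)]
        refine Finset.sum_congr rfl fun β _ => ?_
        by_cases hβ : ∑ i, β i = m
        · rw [dif_pos hβ, show d β = c β from Finsupp.filter_apply_pos _ _ hβ]; rfl
        · rw [dif_neg hβ, show d β = 0 from Finsupp.filter_apply_neg _ _ hβ]; simp
      rw [e1, map_sum, ← hyα]
      simp only [y]
      rw [DFinsupp.finsetSum_apply, AddSubgroup.val_finsetSum]
      refine Finset.sum_congr rfl fun β _ => ?_
      rw [DirectSum.coe_of_apply]
      by_cases hβ : ∑ i, β i = m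
      · rw [dif_pos hβ, if_pos hβ]
        change _ = c β • skewPBWMonomial z β
        rw [hmon m β hβ (skewPBWMonomial_mem S x β hβ.le)]
        exact (L m).map_smul _ _
      · rw [dif_neg hβ, if_neg hβ]; simp
    have hd0 := skewPBW_eq_zero_of_mem_prev S x h m d (by
      intro β hβ
      by_contra hne
      exact hβ (Finsupp.filter_apply_neg _ _ hne)) ((hker m _ hdmem).1 hd)
    have : d α = c α := Finsupp.filter_apply_pos _ _ rfl
    rw [← this, hd0]
  have hspan : ∀ g : G, g ∈ Submodule.span S (Set.range (skewPBWMonomial z)) := by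
    have hr : ∀ (m : ℕ) (a : A) (ha : a ∈ skewPBWFilt S x m),
        gr m ⟨a, ha⟩ ∈ Submodule.span S (Set.range (skewPBWMonomial z)) := by
      intro m a ha
      have hspn := ha
      unfold skewPBWFilt at hspn
      induction hspn using Submodule.span_induction with
      | mem a hspn =>
        obtain ⟨α, hα, rfl⟩ := hspn
        rcases hα.lt_or_eq with hlt | heq
        · rw [(hker m _ ha).2]
          · exact zero_mem _
          · rw [skewPBWFiltPrev_eq]
            exact Submodule.subset_span ⟨α, hlt, rfl⟩
        · rw [← hmon m α heq ha]
          exact Submodule.subset_span ⟨α, rfl⟩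
      | zero =>
        rw [(hker m _ ha).2 (zero_mem _)]
        exact zero_mem _
      | add a b ha1 hb1 iha ihb =>
        have := map_add (gr m) ⟨a, ha1⟩ ⟨b, hb1⟩
        have h2 := add_mem (iha ha1) (ihb hb1)
        rw [← this] at h2
        exact h2
      | smul r a ha1 iha =>
        have := (L m).map_smul r ⟨a, ha1⟩
        have h2 := Submodule.smul_mem _ r (iha ha1)
        exact this ▸ h2
    intro g
    obtain ⟨y, rfl⟩ := hInternal.surjective g
    induction y using DirectSum.induction_on with
    | zero => rw [map_zero]; exact zero_mem _
    | of m y =>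
      rw [DirectSum.coeAddMonoidHom_of]
      obtain ⟨_, ⟨a, ha⟩, rfl⟩ := y
      exact hr m a ha
    | add u v hu hv => rw [map_add]; exact add_mem hu hv
  have hcoeff : ∀ (i : Fin n) (r c : S), x i * (r : A) - (c : A) * x i ∈ (S : Set A) →
      z i * ι r = ι c * z i := by
    intro i r c hc
    have h1 : x i * (r : A) ∈ skewPBWFilt S x 1 :=
      skewPBWFilt_mul S x h 1 0 _ _ (hx i) (hS r)
    have h2 := skewPBWFilt_coe_mul S x c (hx i)
    rw [hιmul c 1 _ (hx i) h2]
    change gr 1 ⟨x i, hx i⟩ * gr 0 ⟨(r : A), hS r⟩ = _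
    rw [hmul 1 0 _ _ (hx i) (hS r) h1]
    exact hsub 1 _ _ h1 h2 (hS ⟨_, hc⟩)
  have hvar : ∀ (i j : Fin n) (c r₀ : S) (r : Fin n → S),
      x j * x i - (c : A) * (x i * x j) = (r₀ : A) + ∑ k, (r k : A) * x k →
      z j * z i = ι c * (z i * z j) := by
    intro i j c r₀ r hc
    have h1 : x j * x i ∈ skewPBWFilt S x (1 + 1) := skewPBWFilt_mul S x h 1 1 _ _ (hx j) (hx i)
    have h2 : x i * x j ∈ skewPBWFilt S x (1 + 1) := skewPBWFilt_mul S x h 1 1 _ _ (hx i) (hx j)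
    have h3 := skewPBWFilt_coe_mul S x c h2
    change gr 1 ⟨x j, hx j⟩ * gr 1 ⟨x i, hx i⟩
      = ι c * (gr 1 ⟨x i, hx i⟩ * gr 1 ⟨x j, hx j⟩)
    rw [hmul 1 1 _ _ (hx j) (hx i) h1, hmul 1 1 _ _ (hx i) (hx j) h2, hιmul c _ _ h2 h3]
    refine hsub _ _ _ h1 h3 ?_
    rw [hc]
    change _ ∈ skewPBWFilt S x 1
    exact add_mem (skewPBWFilt_coe_mem S x 1 r₀)
      (sum_mem fun k _ => skewPBWFilt_coe_mul S x _ (hx k))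
  refine ⟨hιinj, ⟨?_, ?_⟩, ?_, ?_, ?_⟩
  · exact hlin
  · intro g
    obtain ⟨c, hc⟩ := (Finsupp.mem_span_range_iff_exists_finsupp).1 (hspan g)
    exact ⟨c, hc⟩
  · intro i r hr
    obtain ⟨c, hc0, hc⟩ := h.comm_coeff i r hr
    exact ⟨c, hc0, hcoeff i r c hc⟩
  · intro i j
    obtain ⟨c, hc0, r₀, r, hc⟩ := h.comm_var i j
    exact ⟨c, hc0, hvar i j c r₀ r hc⟩
  · rintro ⟨hσ, hu⟩
    constructor
    · intro i
      obtain ⟨σ, δ, -, hδ⟩ := hσ i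
      refine ⟨σ, fun r => hcoeff i r (σ r) ?_⟩
      rw [hδ r, add_sub_cancel_left]
      exact (δ r).2
    · intro i j hij
      obtain ⟨c, hc0, r₀, r, hc⟩ := hu i j hij
      exact ⟨c, hc0, hvar i j c r₀ r hc⟩
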